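/- arXiv:2404.15126 — 4 statements merged into one kernel-verified Lean document; each statement's English description precedes it below -/
import Mathlib

section
/- For every fixed integer d ≥ 1, there exist a constant c > 0 and a threshold N such that for all n ≥ N, the number of ordered triples (σ, π, τ) ∈ (S_n)³ with d_C(σ, π) ≤ d, d_C(π, τ) ≤ d, and d_C(σ, τ) ≤ d is at most c · n! · n^{4d−1}. -/
/-- The Cayley distance between two permutations `π` and `σ` of `Fin n`: the minimum number
`m` of transpositions `φ₁, …, φₘ` such that `π ∘ φ₁ ∘ ⋯ ∘ φₘ = σ`. -/
noncomputable def cayleyDist {n : ℕ} (π σ : Equiv.Perm (Fin n)) : ℕ :=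
  sInf {m | ∃ l : List (Equiv.Perm (Fin n)),
    l.length = m ∧ (∀ φ ∈ l, φ.IsSwap) ∧ π * l.prod = σ}

namespace Equiv.Perm

variable {α : Type*} [Fintype α] [DecidableEq α]

theorem card_support_list_prod_le (l : List (Perm α)) (hl : ∀ φ ∈ l, φ.IsSwap) :
    l.prod.support.card ≤ 2 * l.length := by
  induction l with
  | nil => simp
  | cons φ l ih =>
    have hφ : φ.support.card = 2 := card_support_eq_two.2 (hl φ (by simp))
    have hl' := ih fun ψ hψ => hl ψ (by simp [hψ])
    have hle := (Finset.card_le_card (support_mul_le φ l.prod)).trans (Finset.card_union_le _ _)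
    simp only [List.prod_cons, List.length_cons]
    omega

/-- If `x`, `y` and `x * y` each move at most `2 * d` points, then `x` and `y` together move
fewer than `4 * d` points. -/
theorem card_support_union_lt {d : ℕ} (hd : 1 ≤ d) {x y : Perm α}
    (hx : x.support.card ≤ 2 * d) (hy : y.support.card ≤ 2 * d)
    (hxy : (x * y).support.card ≤ 2 * d) :
    (x.support ∪ y.support).card < 4 * d := by
  by_contra! h
  have hadd := Finset.card_union_add_card_inter x.support y.support
  have hinter : (x.support ∩ y.support).card = 0 := by omega
  have hdisj : x.Disjoint y := by
    rw [disjoint_iff_disjoint_support, Finset.disjoint_iff_inter_eq_empty]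
    exact Finset.card_eq_zero.1 hinter
  have := hdisj.card_support_mul
  omega

/-- A permutation supported in the range of `f` acts on that range through a map of indices. -/
theorem exists_index_map {ι : Type*} {x : Perm α} {f : ι → α}
    (hf : ∀ z ∈ x.support, z ∈ Set.range f) : ∃ a : ι → ι, ∀ i, x (f i) = f (a i) := by
  have (i : ι) : ∃ j, x (f i) = f j := by
    by_cases h : x (f i) = f i
    · exact ⟨i, h⟩
    · obtain ⟨j, hj⟩ := hf (x (f i)) (apply_mem_support.2 (mem_support.2 h))
      exact ⟨j, hj.symm⟩
  choose a ha using this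
  exact ⟨a, ha⟩

theorem eq_of_index_map_eq {ι : Type*} {x y : Perm α} {f : ι → α} {a : ι → ι}
    (hxf : ∀ z ∈ x.support, z ∈ Set.range f) (hyf : ∀ z ∈ y.support, z ∈ Set.range f)
    (hx : ∀ i, x (f i) = f (a i)) (hy : ∀ i, y (f i) = f (a i)) : x = y := by
  ext z
  by_cases hz : z ∈ Set.range f
  · obtain ⟨i, rfl⟩ := hz
    rw [hx, hy]
  · rw [notMem_support.1 fun h => hz (hxf z h), notMem_support.1 fun h => hz (hyf z h)]

/-- The number of pairs of permutations of `Fin n` that together move at most `k` points is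
at most `n ^ k * (k ^ k * k ^ k)`. -/
theorem card_pairs_support_union_le {n k : ℕ} (hkn : k ≤ n) :
    Nat.card {p : Perm (Fin n) × Perm (Fin n) // (p.1.support ∪ p.2.support).card ≤ k} ≤
      n ^ k * (k ^ k * k ^ k) := by
  have key (p : {p : Perm (Fin n) × Perm (Fin n) // (p.1.support ∪ p.2.support).card ≤ k}) :
      ∃ e : (Fin k → Fin n) × (Fin k → Fin k) × (Fin k → Fin k),
        (∀ z ∈ p.1.1.support, z ∈ Set.range e.1) ∧ (∀ z ∈ p.1.2.support, z ∈ Set.range e.1) ∧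
        (∀ i, p.1.1 (e.1 i) = e.1 (e.2.1 i)) ∧ (∀ i, p.1.2 (e.1 i) = e.1 (e.2.2 i)) := by
    obtain ⟨V, hV, hcard⟩ := Finset.exists_superset_card_eq p.2 (by simpa using hkn)
    have hrange : Set.range (V.orderEmbOfFin hcard) = V := V.range_orderEmbOfFin hcard
    have h₁ : ∀ z ∈ p.1.1.support, z ∈ Set.range (V.orderEmbOfFin hcard) := fun z hz => by
      rw [hrange]; exact hV (Finset.mem_union_left _ hz)
    have h₂ : ∀ z ∈ p.1.2.support, z ∈ Set.range (V.orderEmbOfFin hcard) := fun z hz => by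
      rw [hrange]; exact hV (Finset.mem_union_right _ hz)
    obtain ⟨a, ha⟩ := exists_index_map h₁
    obtain ⟨b, hb⟩ := exists_index_map h₂
    exact ⟨(V.orderEmbOfFin hcard, a, b), h₁, h₂, ha, hb⟩
  choose e h₁ h₂ ha hb using key
  have hinj : Function.Injective e := by
    intro p q hpq
    have h₁' := h₁ q
    have h₂' := h₂ q
    have ha' := ha q
    have hb' := hb q
    rw [← hpq] at h₁' h₂' ha' hb'
    exact Subtype.ext (Prod.ext (eq_of_index_map_eq (h₁ p) h₁' (ha p) ha')
      (eq_of_index_map_eq (h₂ p) h₂' (hb p) hb'))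
  simpa [Nat.card_eq_fintype_card] using Nat.card_le_card_of_injective e hinj

end Equiv.Perm

open Equiv.Perm in
theorem card_support_le_of_cayleyDist_le {n d : ℕ} {π σ : Equiv.Perm (Fin n)}
    (h : cayleyDist π σ ≤ d) : (π⁻¹ * σ).support.card ≤ 2 * d := by
  have hne : {m | ∃ l : List (Equiv.Perm (Fin n)),
      l.length = m ∧ (∀ φ ∈ l, φ.IsSwap) ∧ π * l.prod = σ}.Nonempty := by
    obtain ⟨l, hprod, hswap⟩ := swapFactors (π⁻¹ * σ)
    exact ⟨l.length, l, rfl, hswap, by rw [hprod, mul_inv_cancel_left]⟩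
  obtain ⟨l, hlen, hswap, rfl⟩ := Nat.sInf_mem hne
  rw [inv_mul_cancel_left]
  have hl := card_support_list_prod_le l hswap
  unfold cayleyDist at h
  omega

/-- For every fixed `d ≥ 1`, there are `c > 0` and `N` such that for all `n ≥ N`, the number
of ordered triples `(σ, π, τ)` of permutations of `Fin n` with pairwise Cayley distances at
most `d` is at most `c · n! · n^(4d−1)`. -/
theorem cayley_triangle_count (d : ℕ) (hd : 1 ≤ d) :
    ∃ c : ℝ, 0 < c ∧ ∃ N : ℕ, ∀ n : ℕ, N ≤ n →
      (Nat.card {t : Equiv.Perm (Fin n) × Equiv.Perm (Fin n) × Equiv.Perm (Fin n) //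
          cayleyDist t.1 t.2.1 ≤ d ∧ cayleyDist t.2.1 t.2.2 ≤ d ∧
            cayleyDist t.1 t.2.2 ≤ d} : ℝ) ≤
        c * (Nat.factorial n : ℝ) * (n : ℝ) ^ (4 * d - 1) := by
  set k := 4 * d - 1 with hk
  have hkpos : 0 < k := by omega
  refine ⟨((k ^ k * k ^ k : ℕ) : ℝ), by positivity, k, fun n hn => ?_⟩
  let f : {t : Equiv.Perm (Fin n) × Equiv.Perm (Fin n) × Equiv.Perm (Fin n) //
      cayleyDist t.1 t.2.1 ≤ d ∧ cayleyDist t.2.1 t.2.2 ≤ d ∧ cayleyDist t.1 t.2.2 ≤ d} →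
      Equiv.Perm (Fin n) × {p : Equiv.Perm (Fin n) × Equiv.Perm (Fin n) //
        (p.1.support ∪ p.2.support).card ≤ k} := fun t =>
    (t.1.1, ⟨(t.1.1⁻¹ * t.1.2.1, t.1.2.1⁻¹ * t.1.2.2), by
      have hxy := card_support_le_of_cayleyDist_le t.2.2.2
      have := Equiv.Perm.card_support_union_lt hd
        (card_support_le_of_cayleyDist_le t.2.1) (card_support_le_of_cayleyDist_le t.2.2.1)
        (by rwa [mul_assoc, mul_inv_cancel_left])
      exact Nat.le_sub_one_of_lt this⟩)
  have hf : Function.Injective f := by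
    rintro ⟨⟨σ, π, τ⟩, ht⟩ ⟨⟨σ', π', τ'⟩, ht'⟩ h
    simp only [f, Prod.mk.injEq, Subtype.mk.injEq] at h
    obtain ⟨rfl, hπ, hτ⟩ := h
    obtain rfl := mul_left_cancel hπ
    obtain rfl := mul_left_cancel hτ
    rfl
  have hcard := Nat.card_le_card_of_injective f hf
  rw [Nat.card_prod, Nat.card_perm, Nat.card_fin] at hcard
  have hle := hcard.trans
    (Nat.mul_le_mul_left _ (Equiv.Perm.card_pairs_support_union_le (n := n) (k := k) hn))
  calc _ ≤ ((n.factorial * (n ^ k * (k ^ k * k ^ k)) : ℕ) : ℝ) := by exact_mod_cast hle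
    _ = _ := by push_cast; ring
end

section
/- For every fixed integer d ≥ 1, there exist a constant c > 0 and a threshold N such that for all n ≥ N, the number of ordered triples (σ, π, τ) ∈ (S_n)³ with d_K(σ, π) ≤ d, d_K(π, τ) ≤ d, and d_K(σ, τ) ≤ d is at most c · n! · n^{2d−1}. -/
/-- An adjacent transposition of `Fin n`: a swap of two adjacent positions `i` and `i+1`. -/
def IsAdjSwap {n : ℕ} (φ : Equiv.Perm (Fin n)) : Prop :=
  ∃ (i : ℕ) (h1 : i < n) (h2 : i + 1 < n), φ = Equiv.swap ⟨i, h1⟩ ⟨i + 1, h2⟩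

/-- The Kendall τ-distance between two permutations `π` and `σ` of `Fin n`: the minimum number
`m` of adjacent transpositions `φ₁, …, φₘ` such that `π ∘ φ₁ ∘ ⋯ ∘ φₘ = σ`. -/
noncomputable def kendallDist {n : ℕ} (π σ : Equiv.Perm (Fin n)) : ℕ :=
  sInf {m | ∃ l : List (Equiv.Perm (Fin n)),
    l.length = m ∧ (∀ φ ∈ l, IsAdjSwap φ) ∧ π * l.prod = σ}

/-- The adjacent transposition at position `x`; the last position `-1`, which has no successor,
yields the identity. -/
def adjSwap {n : ℕ} [NeZero n] (x : Fin n) : Equiv.Perm (Fin n) :=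
  if x = -1 then 1 else Equiv.swap x (x + 1)

theorem adjSwap_inv {n : ℕ} [NeZero n] (x : Fin n) : (adjSwap x)⁻¹ = adjSwap x := by
  unfold adjSwap
  split_ifs <;> simp

theorem adjSwap_neg_one {n : ℕ} [NeZero n] : adjSwap (-1 : Fin n) = 1 := by
  simp [adjSwap]

theorem prod_map_adjSwap_inv {n : ℕ} [NeZero n] (l : List (Fin n)) :
    ((l.map adjSwap).prod)⁻¹ = (l.reverse.map adjSwap).prod := by
  rw [List.prod_inv_reverse, List.map_map, ← List.map_reverse]
  congr 2
  exact funext adjSwap_inv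

theorem IsAdjSwap.exists_eq_adjSwap {n : ℕ} [NeZero n] {φ : Equiv.Perm (Fin n)}
    (h : IsAdjSwap φ) : ∃ x, φ = adjSwap x := by
  obtain ⟨i, h1, h2, rfl⟩ := h
  have hsucc : (⟨i, h1⟩ + 1 : Fin n) = ⟨i + 1, h2⟩ := by
    apply Fin.ext
    rw [Fin.val_add_one_of_lt' h2]
  refine ⟨⟨i, h1⟩, ?_⟩
  have hne : (⟨i, h1⟩ : Fin n) ≠ -1 := by
    rw [Ne, eq_neg_iff_add_eq_zero, hsucc, Fin.ext_iff]
    simp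
  rw [adjSwap, if_neg hne, hsucc]

theorem exists_list_isAdjSwap {n : ℕ} (π : Equiv.Perm (Fin n)) :
    ∃ l : List (Equiv.Perm (Fin n)), (∀ φ ∈ l, IsAdjSwap φ) ∧ l.prod = π := by
  rcases n with _ | n
  · exact ⟨[], by simp, Subsingleton.elim _ _⟩
  · have h : π ∈ Submonoid.closure
        (Set.range fun i : Fin n ↦ Equiv.swap i.castSucc i.succ) := by
      rw [Equiv.Perm.mclosure_swap_castSucc_succ]
      trivial
    obtain ⟨l, hl, rfl⟩ := Submonoid.exists_list_of_mem_closure h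
    refine ⟨l, fun φ hφ ↦ ?_, rfl⟩
    obtain ⟨i, rfl⟩ := hl φ hφ
    exact ⟨i, by omega, by omega, rfl⟩

theorem exists_adjSwap_word {n d : ℕ} [NeZero n] {π σ : Equiv.Perm (Fin n)}
    (h : kendallDist π σ ≤ d) :
    ∃ l : List (Fin n), l.length = d ∧ σ = π * (l.map adjSwap).prod := by
  have hne : {m | ∃ l : List (Equiv.Perm (Fin n)),
      l.length = m ∧ (∀ φ ∈ l, IsAdjSwap φ) ∧ π * l.prod = σ}.Nonempty := by
    obtain ⟨l, hl, hprod⟩ := exists_list_isAdjSwap (π⁻¹ * σ)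
    exact ⟨l.length, l, rfl, hl, by simp [hprod]⟩
  obtain ⟨l, hlen, hl, rfl⟩ := Nat.sInf_mem hne
  obtain ⟨w, rfl⟩ : ∃ w : List (Fin n), l = w.map adjSwap := by
    clear hlen h hne
    induction l with
    | nil => exact ⟨[], rfl⟩
    | cons φ l ih =>
      obtain ⟨x, rfl⟩ := (hl φ (by simp)).exists_eq_adjSwap
      obtain ⟨w, rfl⟩ := ih fun ψ hψ ↦ hl ψ (by simp [hψ])
      exact ⟨x :: w, rfl⟩
  rw [List.length_map] at hlen
  have hwd : w.length ≤ d := hlen.trans_le h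
  exact ⟨w ++ List.replicate (d - w.length) (-1), by simp [hwd], by simp [adjSwap_neg_one]⟩

theorem card_support_adjSwap_le {n : ℕ} [NeZero n] (x : Fin n) :
    (adjSwap x).support.card ≤ 2 := by
  unfold adjSwap
  split_ifs with h
  · simp
  · by_cases hx : x = x + 1
    · rw [← hx]
      simp
    · rw [Equiv.Perm.card_support_swap hx]

theorem card_support_prod_map_adjSwap_le {n : ℕ} [NeZero n] (l : List (Fin n)) :
    ((l.map adjSwap).prod).support.card ≤ 2 * l.length := by
  induction l with
  | nil => simp
  | cons x l ih =>
    have h1 := Finset.card_le_card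
      (Equiv.Perm.support_mul_le (adjSwap x) (l.map adjSwap).prod)
    have h2 := Finset.card_union_le (adjSwap x).support (l.map adjSwap).prod.support
    have h3 := card_support_adjSwap_le x
    simp only [List.map_cons, List.prod_cons, List.length_cons]
    simp only [Finset.sup_eq_union] at h1
    omega

theorem disjoint_adjSwap {n : ℕ} [NeZero n] {x y : Fin n} (h : x ≠ y) (hxy : x ≠ y + 1)
    (hyx : y ≠ x + 1) : (adjSwap x).Disjoint (adjSwap y) := by
  unfold adjSwap
  split_ifs
  · exact Equiv.Perm.disjoint_one_left _
  · exact Equiv.Perm.disjoint_one_left _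
  · exact Equiv.Perm.disjoint_one_right _
  · intro z
    have h' : x + 1 ≠ y + 1 := fun e ↦ h (add_right_cancel e)
    by_cases hx : z = x
    · subst hx
      exact Or.inr (Equiv.swap_apply_of_ne_of_ne h hxy)
    · by_cases hx' : z = x + 1
      · subst hx'
        exact Or.inr (Equiv.swap_apply_of_ne_of_ne hyx.symm h')
      · exact Or.inl (Equiv.swap_apply_of_ne_of_ne hx hx')

/-- A product of pairwise far apart adjacent transpositions moves twice as many points as it has
factors. -/
theorem card_support_prod_adjSwap_of_far {n k : ℕ} [NeZero n] (hn : 2 ≤ n) (f : Fin k → Fin n)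
    (hlast : ∀ i, f i ≠ -1) (hfar : ∀ i j, i ≠ j → f i ≠ f j ∧ f i ≠ f j + 1) :
    (((List.ofFn f).map adjSwap).prod).support.card = 2 * k := by
  have hcard (i : Fin k) : (adjSwap (f i)).support.card = 2 := by
    have : Nontrivial (Fin n) := Fin.nontrivial_iff_two_le.2 hn
    rw [adjSwap, if_neg (hlast i), Equiv.Perm.card_support_swap]
    simp
    omega
  rw [Equiv.Perm.card_support_prod_list_of_pairwise_disjoint]
  · simp only [List.map_ofFn, List.sum_ofFn, Function.comp_apply, hcard]
    simp [mul_comm]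
  · rw [List.map_ofFn, List.pairwise_ofFn]
    intro i j hij
    exact disjoint_adjSwap (hfar i j hij.ne).1 (hfar i j hij.ne).2 (hfar j i hij.ne').2

/-- Three ways of determining one letter of a word from another letter. -/
def nearbyLetter {n : ℕ} [NeZero n] (e : Fin 3) (x : Fin n) : Fin n :=
  ![x, x + 1, -1] e

/-- If a product of `m + 1` adjacent transpositions moves fewer than `2 * (m + 1)` points, one of
its letters is determined by another one. -/
theorem exists_insertNth_nearbyLetter {n m : ℕ} [NeZero n] (hn : 2 ≤ n) (hm : 1 ≤ m)
    (f : Fin (m + 1) → Fin n)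
    (hf : (((List.ofFn f).map adjSwap).prod).support.card < 2 * (m + 1)) :
    ∃ (i : Fin (m + 1)) (g : Fin m → Fin n) (k : Fin m) (e : Fin 3),
      f = i.insertNth (nearbyLetter e (g k)) g := by
  suffices ∃ (i : Fin (m + 1)) (k : Fin m) (e : Fin 3),
      f i = nearbyLetter e (f (i.succAbove k)) by
    obtain ⟨i, k, e, h⟩ := this
    exact ⟨i, i.removeNth f, k, e, Fin.eq_insertNth_iff.2 ⟨h, rfl⟩⟩
  by_contra! hcon
  refine hf.ne (card_support_prod_adjSwap_of_far hn f
    (fun i ↦ hcon i ⟨0, hm⟩ 2) fun i j hij ↦ ?_)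
  obtain ⟨k, rfl⟩ := Fin.exists_succAbove_eq hij.symm
  exact ⟨hcon i k 0, hcon i k 1⟩

/-- The triple of permutations encoded by a base permutation and a word, whose first `d` letters
lead from the second permutation to the first, and whose other letters lead from the first
permutation to the third. -/
def tripleOfWord {n k : ℕ} [NeZero n] (d : ℕ) (σ : Equiv.Perm (Fin n)) (f : Fin k → Fin n) :
    Equiv.Perm (Fin n) × Equiv.Perm (Fin n) × Equiv.Perm (Fin n) :=
  (σ, σ * ((((List.ofFn f).take d).map adjSwap).prod)⁻¹,
    σ * (((List.ofFn f).drop d).map adjSwap).prod)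

theorem exists_tripleOfWord {n d k : ℕ} [NeZero n] (hk : 2 * d = k)
    {σ π τ : Equiv.Perm (Fin n)} (hσπ : kendallDist σ π ≤ d) (hπτ : kendallDist π τ ≤ d)
    (hστ : kendallDist σ τ ≤ d) :
    ∃ f : Fin k → Fin n, tripleOfWord d σ f = (σ, π, τ) ∧
      (((List.ofFn f).map adjSwap).prod).support.card ≤ 2 * d := by
  obtain ⟨u, hu, rfl⟩ := exists_adjSwap_word hσπ
  obtain ⟨v, hv, rfl⟩ := exists_adjSwap_word hστ
  obtain ⟨w, hw, hvw⟩ := exists_adjSwap_word hπτ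
  have hword : ((u.reverse ++ v).map adjSwap).prod = (w.map adjSwap).prod := by
    rw [List.map_append, List.prod_append, ← prod_map_adjSwap_inv, inv_mul_eq_iff_eq_mul]
    rwa [mul_assoc, mul_right_inj] at hvw
  have hur : u.reverse.length = d := by simp [hu]
  obtain ⟨f, hf⟩ : ∃ f : Fin k → Fin n, List.ofFn f = u.reverse ++ v := by
    obtain rfl : (u.reverse ++ v).length = k := by
      rw [List.length_append]
      omega
    exact ⟨_, List.ofFn_get _⟩
  refine ⟨f, ?_, ?_⟩
  · rw [tripleOfWord, hf, List.take_left' hur, List.drop_left' hur, prod_map_adjSwap_inv,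
      List.reverse_reverse]
  · rw [hf, hword, ← hw]
    exact card_support_prod_map_adjSwap_le w

/-- For every fixed `d ≥ 1`, there are `c > 0` and `N` such that for all `n ≥ N`, the number
of ordered triples `(σ, π, τ)` of permutations of `Fin n` with pairwise Kendall τ-distances at
most `d` is at most `c · n! · n^(2d−1)`. -/
theorem kendall_triangle_count (d : ℕ) (hd : 1 ≤ d) :
    ∃ c : ℝ, 0 < c ∧ ∃ N : ℕ, ∀ n : ℕ, N ≤ n →
      (Nat.card {t : Equiv.Perm (Fin n) × Equiv.Perm (Fin n) × Equiv.Perm (Fin n) //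
          kendallDist t.1 t.2.1 ≤ d ∧ kendallDist t.2.1 t.2.2 ≤ d ∧
            kendallDist t.1 t.2.2 ≤ d} : ℝ) ≤
        c * (Nat.factorial n : ℝ) * (n : ℝ) ^ (2 * d - 1) := by
  obtain ⟨m, hm⟩ : ∃ m, 2 * d = m + 1 := ⟨2 * d - 1, by omega⟩
  have hm1 : 1 ≤ m := by omega
  rw [show 2 * d - 1 = m by omega]
  refine ⟨(m + 1) * m * 3, by positivity, 2, fun n hn ↦ ?_⟩
  have : NeZero n := ⟨by omega⟩
  let F : Equiv.Perm (Fin n) × Fin (m + 1) × (Fin m → Fin n) × Fin m × Fin 3 →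
      Equiv.Perm (Fin n) × Equiv.Perm (Fin n) × Equiv.Perm (Fin n) :=
    fun ⟨σ, i, g, k, e⟩ ↦
      tripleOfWord d σ (i.insertNth (nearbyLetter e (g k)) g : Fin (m + 1) → Fin n)
  have hsub : {t : Equiv.Perm (Fin n) × Equiv.Perm (Fin n) × Equiv.Perm (Fin n) |
      kendallDist t.1 t.2.1 ≤ d ∧ kendallDist t.2.1 t.2.2 ≤ d ∧
        kendallDist t.1 t.2.2 ≤ d} ⊆ Set.range F := by
    rintro ⟨σ, π, τ⟩ ⟨h1, h2, h3⟩
    obtain ⟨f, hf, hcard⟩ := exists_tripleOfWord hm h1 h2 h3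
    obtain ⟨i, g, k, e, rfl⟩ := exists_insertNth_nearbyLetter hn hm1 f (by omega)
    exact ⟨(σ, i, g, k, e), hf⟩
  have hle := (Nat.card_mono (Set.toFinite _) hsub).trans (Finite.card_range_le F)
  have hcard : Nat.card
      (Equiv.Perm (Fin n) × Fin (m + 1) × (Fin m → Fin n) × Fin m × Fin 3) =
      (m + 1) * m * 3 * n.factorial * n ^ m := by
    simp only [Nat.card_eq_fintype_card, Fintype.card_prod, Fintype.card_perm, Fintype.card_fin,
      Fintype.card_fun]
    ring
  rw [hcard] at hle
  exact_mod_cast hle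
end

section
/- For every fixed integer d ≥ 1, there exist a constant c > 0 and a threshold N such that for all n ≥ N, the number of sequences S = (φ_1, …, φ_m) of transpositions of [n] with m ≤ 2d such that d_C(id, id∘φ_1∘⋯∘φ_m) ≤ d is at most c · n^{4d−1}. -/
open Equiv in
theorem card_support_prod_le_of_isSwap {α : Type*} [DecidableEq α] [Fintype α]
    (l : List (Perm α)) (hl : ∀ φ ∈ l, φ.IsSwap) : l.prod.support.card ≤ 2 * l.length := by
  induction l with
  | nil => simp
  | cons φ l ih =>
    have h1 := ih fun ψ hψ => hl ψ (List.mem_cons_of_mem _ hψ)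
    have h2 : φ.support.card = 2 := Perm.card_support_eq_two.mpr (hl φ List.mem_cons_self)
    have h3 := Finset.card_le_card (Perm.support_mul_le φ l.prod)
    have h4 := Finset.card_union_le φ.support l.prod.support
    simp only [List.prod_cons, List.length_cons]
    simp only [Finset.sup_eq_union] at h3
    omega

open Equiv in
theorem card_support_prod_of_pairwise_disjoint_of_isSwap {α : Type*} [DecidableEq α] [Fintype α]
    (l : List (Perm α)) (hl : ∀ φ ∈ l, φ.IsSwap) (hd : l.Pairwise Perm.Disjoint) :
    l.prod.support.card = 2 * l.length := by
  rw [Perm.card_support_prod_list_of_pairwise_disjoint hd,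
    List.map_congr_left (f := Finset.card ∘ Perm.support) (g := fun _ => 2)
      fun φ hφ => Perm.card_support_eq_two.mpr (hl φ hφ)]
  simp [mul_comm]

/-- A product of swaps at Cayley distance at most `d` from the identity moves at most `2 * d`
points. -/
theorem card_support_prod_le_of_cayleyDist_le {n d : ℕ} (l : List (Equiv.Perm (Fin n)))
    (hl : ∀ φ ∈ l, φ.IsSwap) (hd : cayleyDist 1 (1 * l.prod) ≤ d) :
    l.prod.support.card ≤ 2 * d := by
  have hne : {m | ∃ k : List (Equiv.Perm (Fin n)),
      k.length = m ∧ (∀ φ ∈ k, φ.IsSwap) ∧ 1 * k.prod = 1 * l.prod}.Nonempty :=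
    ⟨l.length, l, rfl, hl, rfl⟩
  obtain ⟨k, hk, hks, hkp⟩ := Nat.sInf_mem hne
  have h := card_support_prod_le_of_isSwap k hks
  rw [mul_left_cancel hkp, hk] at h
  exact h.trans (Nat.mul_le_mul_left 2 hd)

/-- A choice of endpoints for each swap, with equal endpoints for the identity. -/
theorem exists_swap_endpoints (α : Type*) [DecidableEq α] [Nonempty α] :
    ∃ p : Equiv.Perm α → Bool → α, ∀ φ, φ.IsSwap ∨ φ = 1 →
      Equiv.swap (p φ true) (p φ false) = φ := by
  have h : ∀ φ : Equiv.Perm α, ∃ q : Bool → α, φ.IsSwap ∨ φ = 1 →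
      Equiv.swap (q true) (q false) = φ := by
    intro φ
    by_cases hs : φ.IsSwap
    · obtain ⟨x, y, -, rfl⟩ := hs
      exact ⟨fun b => if b then x else y, fun _ => by simp⟩
    · refine ⟨fun _ => Classical.arbitrary α, fun h => ?_⟩
      rw [h.resolve_left hs, Equiv.swap_self]
      rfl
  choose p hp using h
  exact ⟨p, hp⟩

theorem card_eq_at_le {ι α : Type*} [Fintype ι] [DecidableEq ι] [Fintype α] [DecidableEq α]
    {i j : ι} (hij : i ≠ j) :
    (Finset.univ.filter fun g : ι → α => g i = g j).card
      ≤ Fintype.card α ^ (Fintype.card ι - 1) := by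
  have hcard : (Finset.univ : Finset ({x : ι // x ≠ j} → α)).card
      = Fintype.card α ^ (Fintype.card ι - 1) := by
    simp [Fintype.card_subtype_compl]
  rw [← hcard]
  refine Finset.card_le_card_of_injOn (fun g x => g x) (fun _ _ => Finset.mem_univ _) ?_
  intro g hg g' hg' h
  simp only [Finset.coe_filter, Finset.mem_univ, true_and, Set.mem_ofPred_eq] at hg hg'
  have hx : ∀ x, x ≠ j → g x = g' x := fun x hx => congrFun h ⟨x, hx⟩
  funext x
  by_cases hxj : x = j
  · rw [hxj, ← hg, ← hg', hx i hij]
  · exact hx x hxj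

theorem card_not_injective_le (ι α : Type*) [Fintype ι] [Fintype α] :
    Nat.card {g : ι → α // ¬ Function.Injective g}
      ≤ Fintype.card ι ^ 2 * Fintype.card α ^ (Fintype.card ι - 1) := by
  classical
  rw [Nat.card_eq_fintype_card, Fintype.card_subtype]
  have hsub : (Finset.univ.filter fun g : ι → α => ¬ Function.Injective g) ⊆
      (Finset.univ : Finset ι).offDiag.biUnion
        fun q => Finset.univ.filter fun g : ι → α => g q.1 = g q.2 := by
    intro g hg
    simp only [Finset.mem_filter, Finset.mem_univ, true_and, Function.Injective,
      not_forall] at hg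
    obtain ⟨i, j, h, hne⟩ := hg
    simp only [Finset.mem_biUnion, Finset.mem_offDiag, Finset.mem_filter, Finset.mem_univ,
      true_and]
    exact ⟨(i, j), hne, h⟩
  refine (Finset.card_le_card hsub).trans
    ((Finset.card_biUnion_le_card_mul _ _ _ fun q hq =>
      card_eq_at_le (Finset.mem_offDiag.mp hq).2.2).trans (Nat.mul_le_mul_right _ ?_))
  rw [Finset.offDiag_card, Finset.card_univ, sq]
  exact Nat.sub_le _ _

/-- Lists of swaps whose endpoints are all distinct have a product with support of
full size. -/
theorem card_support_prod_of_injective_endpoints {α : Type*} [DecidableEq α] [Fintype α]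
    (p : Equiv.Perm α → Bool → α) (l : List (Equiv.Perm α)) (hl : ∀ φ ∈ l, φ.IsSwap)
    (hp : ∀ φ ∈ l, Equiv.swap (p φ true) (p φ false) = φ)
    (hinj : Function.Injective fun x : Fin l.length × Bool => p l[x.1] x.2) :
    l.prod.support.card = 2 * l.length := by
  refine card_support_prod_of_pairwise_disjoint_of_isSwap l hl ?_
  rw [List.pairwise_iff_getElem]
  intro i j hi hj hij
  have hne : ∀ b b', p l[i] b ≠ p l[j] b' := by
    intro b b' h
    have := @hinj (⟨i, hi⟩, b) (⟨j, hj⟩, b') h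
    simp only [Prod.mk.injEq, Fin.mk.injEq] at this
    omega
  have hsupp : ∀ φ ∈ l, ∀ x, φ x ≠ x → x = p φ true ∨ x = p φ false := by
    intro φ hφ x hx
    by_contra! h
    rw [← hp φ hφ] at hx
    exact hx (Equiv.swap_apply_of_ne_of_ne h.1 h.2)
  intro x
  by_contra! h
  rcases hsupp _ (List.getElem_mem hi) x h.1 with h1 | h1 <;>
    rcases hsupp _ (List.getElem_mem hj) x h.2 with h2 | h2 <;>
    exact hne _ _ (h1.symm.trans h2)

/-- For every fixed `d ≥ 1`, there are `c > 0` and `N` such that for all `n ≥ N`, the number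
of sequences `S = (φ₁, …, φₘ)` of transpositions of `Fin n` with `m ≤ 2d` such that
`d_C(id, id ∘ φ₁ ∘ ⋯ ∘ φₘ) ≤ d` is at most `c · n^(4d−1)`. -/
theorem cayley_sequence_count (d : ℕ) (hd : 1 ≤ d) :
    ∃ c : ℝ, 0 < c ∧ ∃ N : ℕ, ∀ n : ℕ, N ≤ n →
      (Nat.card {l : List (Equiv.Perm (Fin n)) //
          l.length ≤ 2 * d ∧ (∀ φ ∈ l, φ.IsSwap) ∧
            cayleyDist 1 (1 * l.prod) ≤ d} : ℝ) ≤
        c * (n : ℝ) ^ (4 * d - 1) := by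
  refine ⟨((4 * d) ^ 2 * (2 * d + 1) : ℕ), by positivity, 1, fun n hn => ?_⟩
  have : NeZero n := ⟨by omega⟩
  obtain ⟨p, hp⟩ := exists_swap_endpoints (Fin n)
  have hp1 : p 1 true = p 1 false := Equiv.swap_eq_one_iff.mp (hp 1 (Or.inr rfl))
  let endpoints (l : List (Equiv.Perm (Fin n))) : Fin (2 * d) × Bool → Fin n :=
    fun x => p (l.getD x.1 1) x.2
  have hnot : ∀ l : List (Equiv.Perm (Fin n)), l.length ≤ 2 * d → (∀ φ ∈ l, φ.IsSwap) →
      cayleyDist 1 (1 * l.prod) ≤ d → ¬ Function.Injective (endpoints l) := by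
    intro l hlen hl hdist hinj
    rcases hlen.lt_or_eq with hlt | heq
    · have h := @hinj (⟨l.length, hlt⟩, true) (⟨l.length, hlt⟩, false)
        (by simpa [endpoints] using hp1)
      simp at h
    · have hle := card_support_prod_le_of_cayleyDist_le l hl hdist
      rw [card_support_prod_of_injective_endpoints p l hl (fun φ hφ => hp φ (Or.inl (hl φ hφ)))]
        at hle
      · omega
      · intro x y hxy
        have h := @hinj (Fin.cast heq x.1, x.2) (Fin.cast heq y.1, y.2)
          (by simpa [endpoints] using hxy)
        simpa [Prod.ext_iff] using h
  let F : {l : List (Equiv.Perm (Fin n)) // l.length ≤ 2 * d ∧ (∀ φ ∈ l, φ.IsSwap) ∧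
      cayleyDist 1 (1 * l.prod) ≤ d} →
      {g : Fin (2 * d) × Bool → Fin n // ¬ Function.Injective g} × Fin (2 * d + 1) :=
    fun l => (⟨endpoints l.1, hnot l.1 l.2.1 l.2.2.1 l.2.2.2⟩,
      ⟨l.1.length, Nat.lt_succ_of_le l.2.1⟩)
  have hF : Function.Injective F := by
    rintro ⟨l, hlen, hl, hl'⟩ ⟨k, hklen, hk, hk'⟩ h
    simp only [F, Prod.mk.injEq, Subtype.mk.injEq, Fin.mk.injEq] at h ⊢
    refine List.ext_getElem h.2 fun i hi hi' => ?_
    have hb : ∀ b, p l[i] b = p k[i] b := fun b => by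
      simpa [endpoints, hi, hi'] using congrFun h.1 (⟨i, hi.trans_le hlen⟩, b)
    rw [← hp l[i] (Or.inl (hl _ (List.getElem_mem hi))), hb, hb,
      hp k[i] (Or.inl (hk _ (List.getElem_mem hi')))]
  have hcard := Nat.card_le_card_of_injective F hF
  rw [Nat.card_prod, Nat.card_fin] at hcard
  have hg := card_not_injective_le (Fin (2 * d) × Bool) (Fin n)
  simp only [Fintype.card_prod, Fintype.card_fin, Fintype.card_bool] at hg
  rw [show 2 * d * 2 = 4 * d by ring] at hg
  calc (Nat.card _ : ℝ)
      ≤ (((4 * d) ^ 2 * n ^ (4 * d - 1) * (2 * d + 1) : ℕ) : ℝ) :=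
        Nat.cast_le.mpr (hcard.trans (Nat.mul_le_mul_right _ hg))
    _ = _ := by push_cast; ring
end

section
/- For every fixed integer d ≥ 1, there exist a constant c > 0 and a threshold N such that for all n ≥ N, the number of sequences S = (φ_1, …, φ_m) of adjacent transpositions of [n] with m ≤ 2d such that d_K(id, id∘φ_1∘⋯∘φ_m) ≤ d is at most c · n^{2d−1}. -/
/-- A permutation preserves the initial segment `{x | x ≤ i}`. -/
def PreservesInitial {n : ℕ} (i : ℕ) (g : Equiv.Perm (Fin n)) : Prop :=
  ∀ x, (g x).val ≤ i ↔ x.val ≤ i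

lemma PreservesInitial.list_prod {n i : ℕ} {l : List (Equiv.Perm (Fin n))}
    (h : ∀ φ ∈ l, PreservesInitial i φ) : PreservesInitial i l.prod := by
  induction l with
  | nil => intro x; simp
  | cons a l ih =>
    intro x
    rw [List.prod_cons, Equiv.Perm.mul_apply, h a (by simp), ih (fun φ hφ => h φ (by simp [hφ]))]

lemma IsAdjSwap.preservesInitial {n i : ℕ} (h1 : i < n) (h2 : i + 1 < n)
    {ψ : Equiv.Perm (Fin n)} (hψ : IsAdjSwap ψ)
    (hne : ψ ≠ Equiv.swap ⟨i, h1⟩ ⟨i + 1, h2⟩) : PreservesInitial i ψ := by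
  obtain ⟨j, k1, k2, rfl⟩ := hψ
  have hij : j ≠ i := by rintro rfl; exact hne rfl
  intro x
  rw [Equiv.swap_apply_def]
  split_ifs with ha hb
  · subst ha; simp only; omega
  · subst hb; simp only; omega
  · rfl

/-- A product of distinct adjacent transpositions is a reduced word. -/
lemma length_le_of_nodup_of_prod_eq {n : ℕ} {l l' : List (Equiv.Perm (Fin n))}
    (hl : ∀ φ ∈ l, IsAdjSwap φ) (hl' : ∀ φ ∈ l', IsAdjSwap φ) (hnd : l.Nodup)
    (heq : l'.prod = l.prod) : l.length ≤ l'.length := by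
  refine (hnd.subperm fun φ hφ => ?_).length_le
  by_contra hφ'
  obtain ⟨i, h1, h2, hi⟩ := hl φ hφ
  obtain ⟨a, b, rfl⟩ := List.append_of_mem hφ
  rw [List.nodup_append] at hnd
  obtain ⟨-, hb, hab⟩ := hnd
  have hpa : PreservesInitial i a.prod := PreservesInitial.list_prod fun ψ hψ =>
    (hl ψ (by simp [hψ])).preservesInitial h1 h2 (hi ▸ hab ψ hψ φ (by simp))
  have hpb : PreservesInitial i b.prod := PreservesInitial.list_prod fun ψ hψ =>
    (hl ψ (by simp [hψ])).preservesInitial h1 h2 fun h =>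
      (List.nodup_cons.1 hb).1 (hi.trans h.symm ▸ hψ)
  have hpl : PreservesInitial i l'.prod := PreservesInitial.list_prod fun ψ hψ =>
    (hl' ψ hψ).preservesInitial h1 h2 fun h => hφ' (hi.trans h.symm ▸ hψ)
  have key := hpl (b.prod⁻¹ ⟨i, h1⟩)
  rw [heq, ← hpb (b.prod⁻¹ ⟨i, h1⟩), List.prod_append, List.prod_cons, Equiv.Perm.mul_apply, hpa,
    Equiv.Perm.mul_apply, ← Equiv.Perm.mul_apply b.prod, mul_inv_cancel, Equiv.Perm.one_apply, hi,
    Equiv.swap_apply_left] at key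
  simp at key

lemma length_le_kendallDist_of_nodup {n : ℕ} {l : List (Equiv.Perm (Fin n))}
    (hl : ∀ φ ∈ l, IsAdjSwap φ) (hnd : l.Nodup) : l.length ≤ kendallDist 1 (1 * l.prod) := by
  obtain ⟨l', hlen, hl', heq⟩ := Nat.sInf_mem
    (s := {m | ∃ l' : List (Equiv.Perm (Fin n)),
      l'.length = m ∧ (∀ φ ∈ l', IsAdjSwap φ) ∧ 1 * l'.prod = 1 * l.prod}) ⟨_, l, rfl, hl, rfl⟩
  rw [kendallDist, ← hlen]
  exact length_le_of_nodup_of_prod_eq hl hl' hnd (by simpa using heq)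

/-- The lists of length at most `D` with entries in the range of `s`. -/
def boundedLists {ι α : Type*} (s : ι → α) (D : ℕ) : Set (List α) :=
  {l | l.length ≤ D ∧ ∀ a ∈ l, a ∈ Set.range s}

lemma boundedLists_subset_range {ι α : Type*} [Nonempty ι] (s : ι → α) (D : ℕ) :
    boundedLists s D ⊆ Set.range fun p : Fin (D + 1) × (Fin D → ι) =>
      ((List.ofFn p.2).take p.1).map s := by
  rintro l ⟨hlen, hl⟩
  obtain ⟨k, rfl⟩ : l ∈ Set.range (List.map s) := by
    rw [Set.range_list_map]; exact hl
  rw [List.length_map] at hlen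
  obtain ⟨x⟩ := ‹Nonempty ι›
  refine ⟨(⟨k.length, by omega⟩, fun j => k.getD j x), ?_⟩
  apply List.ext_getElem
  · simp [hlen]
  · intro j h1 h2
    have h3 : j < k.length := by simpa using h2
    simp [h3]

lemma boundedLists_finite {ι α : Type*} [Finite ι] [Nonempty ι] (s : ι → α) (D : ℕ) :
    (boundedLists s D).Finite :=
  (Set.finite_range _).subset (boundedLists_subset_range s D)

lemma ncard_boundedLists_le {ι α : Type*} [Finite ι] [Nonempty ι] (s : ι → α) (D : ℕ) :
    (boundedLists s D).ncard ≤ (D + 1) * Nat.card ι ^ D := by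
  refine (Set.ncard_le_ncard (boundedLists_subset_range s D) (Set.finite_range _)).trans ?_
  rw [← Set.image_univ]
  refine (Set.ncard_image_le Set.finite_univ).trans ?_
  rw [Set.ncard_univ, Nat.card_prod, Nat.card_fun]
  simp

/-- A list with a repetition is obtained from a shorter list by copying one of its entries. -/
lemma exists_insertIdx_of_not_nodup {α : Type*} {l : List α} (h : ¬ l.Nodup) (a₀ : α) :
    ∃ i < l.length, ∃ j < l.length,
      (l.eraseIdx j).insertIdx j ((l.eraseIdx j).getD i a₀) = l := by
  rw [List.nodup_iff_injective_getElem, Function.Injective] at h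
  push Not at h
  obtain ⟨i, j, hij, hne⟩ := h
  wlog hlt : i < j generalizing i j
  · exact this j i hij.symm hne.symm (lt_of_le_of_ne (not_lt.1 hlt) hne.symm)
  refine ⟨i, i.2, j, j.2, ?_⟩
  have hlt' : i.val < j.val := hlt
  have hj := j.2
  have : (l.eraseIdx j).getD i a₀ = l[j.val] := by
    rw [List.getD_eq_getElem _ _ (by rw [List.length_eraseIdx_of_lt hj]; omega),
      List.getElem_eraseIdx_of_lt _ hlt']
    exact hij
  rw [this]
  exact List.insertIdx_eraseIdx_getElem hj

/-- The lists of length at most `D + 1` with entries in the range of `s`, those of length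
`D + 1` having a repetition. -/
lemma ncard_le_of_repetition {ι α : Type*} [Finite ι] [Nonempty ι] (s : ι → α) (D : ℕ)
    (S : Set (List α))
    (hS : ∀ l ∈ S, l.length ≤ D + 1 ∧ (∀ a ∈ l, a ∈ Set.range s) ∧
      (l.length = D + 1 → ¬ l.Nodup)) :
    S.ncard ≤ (1 + (D + 1) * (D + 1)) * ((D + 1) * Nat.card ι ^ D) := by
  obtain ⟨x⟩ := ‹Nonempty ι›
  have : Nonempty ι := ⟨x⟩
  set L := boundedLists s D
  have hLfin : L.Finite := boundedLists_finite s D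
  let P : Set ((Fin (D + 1) × Fin (D + 1)) × List α) := Set.univ ×ˢ L
  let G : (Fin (D + 1) × Fin (D + 1)) × List α → List α :=
    fun p => p.2.insertIdx p.1.2 (p.2.getD p.1.1 (s x))
  have hPfin : P.Finite := Set.finite_univ.prod hLfin
  have hsub : S ⊆ L ∪ G '' P := by
    intro l hl
    obtain ⟨hlen, hmem, hrep⟩ := hS l hl
    by_cases h : l.length = D + 1
    · obtain ⟨i, hi, j, hj, hij⟩ := exists_insertIdx_of_not_nodup (hrep h) (s x)
      refine Or.inr ⟨((⟨i, h ▸ hi⟩, ⟨j, h ▸ hj⟩), l.eraseIdx j), ⟨Set.mem_univ _, ?_, ?_⟩, hij⟩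
      · simp only [List.length_eraseIdx_of_lt hj]; omega
      · exact fun a ha => hmem a (List.mem_of_mem_eraseIdx ha)
    · exact Or.inl ⟨by omega, hmem⟩
  have hP : P.ncard = (D + 1) * (D + 1) * L.ncard := by
    rw [Set.ncard_prod, Set.ncard_univ]
    simp
  calc S.ncard ≤ (L ∪ G '' P).ncard := Set.ncard_le_ncard hsub (hLfin.union (hPfin.image G))
    _ ≤ L.ncard + (G '' P).ncard := Set.ncard_union_le _ _
    _ ≤ L.ncard + P.ncard := by gcongr; exact Set.ncard_image_le hPfin
    _ = (1 + (D + 1) * (D + 1)) * L.ncard := by rw [hP]; ring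
    _ ≤ _ := by gcongr; exact ncard_boundedLists_le s D

/-- Adjacent transpositions of `Fin n` are indexed by `Fin n`. -/
lemma exists_range_adjSwap (n : ℕ) :
    ∃ s : Fin n → Equiv.Perm (Fin n), ∀ φ, IsAdjSwap φ → φ ∈ Set.range s := by
  refine ⟨fun i => if h : i.val + 1 < n then Equiv.swap i ⟨i + 1, h⟩ else 1, ?_⟩
  rintro φ ⟨i, h1, h2, rfl⟩
  exact ⟨⟨i, h1⟩, by simp [h2]⟩


/-- For every fixed `d ≥ 1`, there are `c > 0` and `N` such that for all `n ≥ N`, the number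
of sequences `S = (φ₁, …, φₘ)` of adjacent transpositions of `Fin n` with `m ≤ 2d` such that
`d_K(id, id ∘ φ₁ ∘ ⋯ ∘ φₘ) ≤ d` is at most `c · n^(2d−1)`. -/
theorem kendall_sequence_count (d : ℕ) (hd : 1 ≤ d) :
    ∃ c : ℝ, 0 < c ∧ ∃ N : ℕ, ∀ n : ℕ, N ≤ n →
      (Nat.card {l : List (Equiv.Perm (Fin n)) //
          l.length ≤ 2 * d ∧ (∀ φ ∈ l, IsAdjSwap φ) ∧
            kendallDist 1 (1 * l.prod) ≤ d} : ℝ) ≤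
        c * (n : ℝ) ^ (2 * d - 1) := by
  have hD : 2 * d - 1 + 1 = 2 * d := by omega
  refine ⟨((1 + 2 * d * (2 * d)) * (2 * d) : ℕ), by positivity, 1, fun n hn => ?_⟩
  obtain ⟨s, hs⟩ := exists_range_adjSwap n
  have : Nonempty (Fin n) := ⟨⟨0, hn⟩⟩
  have key := ncard_le_of_repetition s (2 * d - 1)
    {l | l.length ≤ 2 * d ∧ (∀ φ ∈ l, IsAdjSwap φ) ∧ kendallDist 1 (1 * l.prod) ≤ d} (by
      rintro l ⟨hlen, hadj, hdist⟩
      refine ⟨by omega, fun φ hφ => hs φ (hadj φ hφ), fun h hnd => ?_⟩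
      have := length_le_kendallDist_of_nodup hadj hnd
      omega)
  rw [hD, Nat.card_fin, ← mul_assoc, ← Nat.card_coe_set_eq] at key
  exact_mod_cast key
end
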